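/- On Ran(H_u), the operators T and T* differ by a rank-one operator: T f = T* f - (1/(2πi)) (f, g) g for all f ∈ Ran(H_u), where g is the unique element of Ran(H_u) with H_u(g) = u. -/

import Mathlib

open MeasureTheory Complex Filter

lemma aux_ne (p : ℂ) : ∀ᶠ z in Bornology.cobounded ℂ, z - p ≠ 0 := by
  filter_upwards [eventually_cobounded_le_norm (‖p‖ + 1)] with z hz h
  have : z = p := sub_eq_zero.mp h
  rw [this] at hz
  linarith

lemma aux_inv (p : ℂ) :
    (fun z : ℂ => (z - p)⁻¹) =O[Bornology.cobounded ℂ] (fun z => z⁻¹) := by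
  refine Asymptotics.IsBigO.of_bound 2 ?_
  filter_upwards [eventually_cobounded_le_norm (2 * ‖p‖ + 1)] with z hz
  have h1 : ‖z‖ - ‖p‖ ≤ ‖z - p‖ := norm_sub_norm_le z p
  have h0 := norm_nonneg p
  rw [norm_inv, norm_inv, ← div_eq_mul_inv, inv_eq_one_div, div_le_div_iff₀ (by linarith) (by linarith)]
  linarith

lemma aux_inv_one :
    (fun z : ℂ => z⁻¹) =O[Bornology.cobounded ℂ] (fun _ => (1 : ℂ)) :=
  tendsto_inv₀_cobounded.isBigO_one ℂ

lemma aux_int (F : ℂ → ℂ) (hd : ∀ z : ℂ, 0 ≤ z.im → DifferentiableAt ℂ F z)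
    (hO : F =O[Bornology.cobounded ℂ] (fun z => (z⁻¹) ^ 2)) :
    Integrable (fun x : ℝ => F x) ∧ ∫ x : ℝ, F x = 0 := by
  have hcont : Continuous (fun x : ℝ => F x) := by
    rw [continuous_iff_continuousAt]
    intro x
    have h1 : ContinuousAt F (x : ℂ) := (hd x (by simp)).continuousAt
    exact ContinuousAt.comp (f := fun x : ℝ => (x : ℂ)) h1 Complex.continuous_ofReal.continuousAt
  have hint : Integrable (fun x : ℝ => F x) := by
    refine hcont.locallyIntegrable.integrable_of_isBigO_cocompact (g := fun x : ℝ => (1 + x ^ 2)⁻¹) ?_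
      (integrable_inv_one_add_sq.integrableAtFilter _)
    rw [← Metric.cobounded_eq_cocompact]
    have ht : Tendsto (fun x : ℝ => (x : ℂ)) (Bornology.cobounded ℝ) (Bornology.cobounded ℂ) :=
      RCLike.tendsto_ofReal_cobounded_cobounded ℂ
    refine (hO.comp_tendsto ht).trans ?_
    refine Asymptotics.IsBigO.of_bound 2 ?_
    filter_upwards [eventually_cobounded_le_norm 1] with x hx
    have h2 : 1 ≤ x ^ 2 := by
      rw [← sq_abs]; rw [Real.norm_eq_abs] at hx; nlinarith
    simp only [Function.comp, norm_pow, norm_inv, Complex.norm_real, Real.norm_eq_abs, inv_pow, sq_abs]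
    rw [abs_of_nonneg (by positivity : (0:ℝ) ≤ 1 + x ^ 2), ← div_eq_mul_inv, inv_eq_one_div,
      div_le_div_iff₀ (by linarith) (by linarith)]
    linarith
  refine ⟨hint, ?_⟩
  have hlim := intervalIntegral_tendsto_integral hint tendsto_neg_atTop_atBot tendsto_id
  obtain ⟨C, hC0, hC⟩ := hO.exists_pos
  have hC := hC.bound
  rw [(hasBasis_cobounded_norm (E := ℂ)).eventually_iff] at hC
  obtain ⟨R0, -, hR0⟩ := hC
  have hzero : Tendsto (fun R : ℝ => ∫ x in (-R)..(id R), F x) atTop (nhds 0) := by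
    refine squeeze_zero_norm' (a := fun R : ℝ => 4 * C * R⁻¹) ?_ ?_
    · filter_upwards [eventually_ge_atTop R0, eventually_gt_atTop 0] with R hR hRpos
      have hb : ∀ z : ℂ, R ≤ ‖z‖ → ‖F z‖ ≤ C * (R⁻¹) ^ 2 := by
        intro z hz
        have := @hR0 z (hR.trans hz)
        refine this.trans ?_
        rw [norm_pow, norm_inv]
        gcongr
      have hrect := integral_boundary_rect_eq_zero_of_differentiableOn F ((-R : ℝ) : ℂ) ((R : ℂ) + R * I)
        (by
          intro z hz
          refine (hd z ?_).differentiableWithinAt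
          have := hz.2
          simp [Set.uIcc_of_le hRpos.le] at this
          exact this.1)
      simp only [ofReal_re, ofReal_im, add_re, add_im, mul_re, mul_im, I_re, I_im, mul_zero, mul_one,
        sub_zero, add_zero, zero_add, ofReal_zero, zero_mul, smul_eq_mul, sub_self] at hrect
      have e1 : ‖∫ x : ℝ in (-R)..R, F (x + R * I)‖ ≤ C * (R⁻¹) ^ 2 * |R - (-R)| := by
        refine intervalIntegral.norm_integral_le_of_norm_le_const ?_
        intro x _
        apply hb
        have := Complex.abs_im_le_norm ((x : ℂ) + R * I)
        simp at this
        exact (le_abs_self R).trans this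
      have e2 : ‖∫ y : ℝ in (0:ℝ)..R, F (R + y * I)‖ ≤ C * (R⁻¹) ^ 2 * |R - 0| := by
        refine intervalIntegral.norm_integral_le_of_norm_le_const ?_
        intro x _
        apply hb
        have := Complex.abs_re_le_norm ((R : ℂ) + x * I)
        simp at this
        exact (le_abs_self R).trans this
      have e3 : ‖∫ y : ℝ in (0:ℝ)..R, F ((-R : ℝ) + y * I)‖ ≤ C * (R⁻¹) ^ 2 * |R - 0| := by
        refine intervalIntegral.norm_integral_le_of_norm_le_const ?_
        intro x _
        apply hb
        have := Complex.abs_re_le_norm (((-R : ℝ) : ℂ) + x * I)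
        simp at this
        refine (le_abs_self R).trans ?_
        simpa using this
      have key : (∫ x in (-R)..(id R), F x) = (∫ x : ℝ in (-R)..R, F (x + R * I))
          - I * (∫ y : ℝ in (0:ℝ)..R, F (R + y * I)) + I * (∫ y : ℝ in (0:ℝ)..R, F ((-R : ℝ) + y * I)) := by
        simp only [id]
        linear_combination hrect
      rw [key]
      refine (norm_add_le _ _).trans ?_
      refine (add_le_add_left (norm_sub_le _ _) _).trans ?_
      rw [norm_mul, norm_mul, norm_I, one_mul, one_mul]
      rw [abs_of_pos (by linarith)] at e1 e2 e3
      have : C * (R⁻¹) ^ 2 * (R - (-R)) + C * (R⁻¹) ^ 2 * (R - 0) + C * (R⁻¹) ^ 2 * (R - 0) = 4 * C * R⁻¹ := by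
        field_simp; ring
      linarith
    · simpa using tendsto_inv_atTop_zero.const_mul (4 * C)
  exact tendsto_nhds_unique hlim hzero

lemma aux_int' (F : ℂ → ℂ) (hd : ∀ z : ℂ, z.im ≤ 0 → DifferentiableAt ℂ F z)
    (hO : F =O[Bornology.cobounded ℂ] (fun z => (z⁻¹) ^ 2)) :
    Integrable (fun x : ℝ => F x) ∧ ∫ x : ℝ, F x = 0 := by
  have h := aux_int (fun z => F (-z)) (fun z hz => by
      have h1 : DifferentiableAt ℂ F (-z) := hd (-z) (by simpa using hz)
      exact DifferentiableAt.comp (f := fun z : ℂ => -z) z h1 differentiableAt_id.neg)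
    (by
      have ht : Tendsto (fun z : ℂ => -z) (Bornology.cobounded ℂ) (Bornology.cobounded ℂ) := by
        rw [← tendsto_norm_atTop_iff_cobounded]
        simpa using tendsto_norm_cobounded_atTop (E := ℂ)
      refine (hO.comp_tendsto ht).congr_right ?_
      intro z
      simp [inv_neg])
  obtain ⟨h1, h2⟩ := h
  constructor
  · have := h1.comp_neg
    simpa using this
  · rw [← h2, ← integral_neg_eq_self (fun x : ℝ => F x)]
    simp

/-- asymptotic expansion predicate -/
def AuxD (h : ℂ → ℂ) (c : ℂ) : Prop :=
  (fun z => h z - c * z⁻¹) =O[Bornology.cobounded ℂ] (fun z => (z⁻¹) ^ 2)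

def AuxB (b : ℂ → ℂ) : Prop :=
  (fun z => b z - 1) =O[Bornology.cobounded ℂ] (fun z => z⁻¹)

lemma AuxD.congr {h h' : ℂ → ℂ} {c : ℂ} (H : AuxD h c)
    (e : h =ᶠ[Bornology.cobounded ℂ] h') : AuxD h' c := by
  refine Asymptotics.IsBigO.congr' H ?_ EventuallyEq.rfl
  filter_upwards [e] with z hz
  rw [hz]

lemma AuxB.one {b : ℂ → ℂ} (H : AuxB b) : b =O[Bornology.cobounded ℂ] (fun _ => (1 : ℂ)) := by
  have := (Asymptotics.IsBigO.trans H aux_inv_one).add (Asymptotics.isBigO_refl (fun _ : ℂ => (1:ℂ)) _)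
  simpa using this

lemma AuxB.mul {b b' : ℂ → ℂ} (H : AuxB b) (H' : AuxB b') : AuxB (fun z => b z * b' z) := by
  have h1 := Asymptotics.IsBigO.mul H H'.one
  have h2 := Asymptotics.IsBigO.add (by simpa using h1) H'
  refine h2.congr_left ?_
  intro z; ring

lemma AuxB.triv : AuxB (fun _ => 1) := by
  unfold AuxB; simp [Asymptotics.isBigO_zero]

lemma AuxB.pow {b : ℂ → ℂ} (H : AuxB b) (n : ℕ) : AuxB (fun z => b z ^ n) := by
  induction n with
  | zero => simpa using AuxB.triv
  | succ n ih => simpa [pow_succ] using ih.mul H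

lemma AuxB.prod {ι : Type*} (s : Finset ι) (b : ι → ℂ → ℂ) (H : ∀ i, AuxB (b i)) :
    AuxB (fun z => ∏ i ∈ s, b i z) := by
  classical
  induction s using Finset.induction_on with
  | empty => simpa using AuxB.triv
  | insert i s hi ih =>
    simp only [Finset.prod_insert hi]
    exact (H i).mul ih

lemma AuxB.frac (p q : ℂ) : AuxB (fun z => (z - p) / (z - q)) := by
  have h := (aux_inv q).const_mul_left (q - p)
  refine Asymptotics.IsBigO.congr' h ?_ EventuallyEq.rfl
  filter_upwards [aux_ne q] with z hz
  field_simp; ring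

lemma AuxD.mul {h b : ℂ → ℂ} {c : ℂ} (H : AuxD h c) (H' : AuxB b) : AuxD (fun z => h z * b z) c := by
  have h1 := Asymptotics.IsBigO.mul H H'.one
  have h2 := ((Asymptotics.isBigO_refl (fun z : ℂ => z⁻¹) (Bornology.cobounded ℂ)).const_mul_left c).mul H'
  have h1' := h1.congr_right (g₂ := fun z : ℂ => (z⁻¹) ^ 2) (fun z => by ring)
  have h2' := h2.congr_right (g₂ := fun z : ℂ => (z⁻¹) ^ 2) (fun z => by ring)
  refine (h1'.add h2').congr_left ?_
  intro z; ring

lemma AuxD.add {h h' : ℂ → ℂ} {c c' : ℂ} (H : AuxD h c) (H' : AuxD h' c') :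
    AuxD (fun z => h z + h' z) (c + c') := by
  refine (Asymptotics.IsBigO.add H H').congr_left ?_
  intro z; ring

lemma AuxD.smul {h : ℂ → ℂ} {c : ℂ} (a : ℂ) (H : AuxD h c) : AuxD (fun z => a * h z) (a * c) := by
  refine (Asymptotics.IsBigO.const_mul_left H a).congr_left ?_
  intro z; ring

lemma AuxD.sum {ι : Type*} (s : Finset ι) (h : ι → ℂ → ℂ) (H : ∀ i, ∃ c, AuxD (h i) c) :
    ∃ c, AuxD (fun z => ∑ i ∈ s, h i z) c := by
  classical
  choose c hc using H
  refine ⟨∑ i ∈ s, c i, ?_⟩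
  induction s using Finset.induction_on with
  | empty => unfold AuxD; simp [Asymptotics.isBigO_zero]
  | insert i s hi ih =>
    simp only [Finset.sum_insert hi]
    exact (hc i).add ih

lemma AuxD.inv (p : ℂ) : AuxD (fun z => (z - p)⁻¹) 1 := by
  have h := ((aux_inv p).mul (Asymptotics.isBigO_refl (fun z : ℂ => z⁻¹) _)).const_mul_left p
  refine Asymptotics.IsBigO.congr' h ?_ (by simp [pow_two])
  filter_upwards [aux_ne p, aux_ne 0] with z hz hz0
  rw [sub_zero] at hz0
  field_simp; ring

lemma AuxD.inv_pow (p : ℂ) (n : ℕ) : ∃ c, AuxD (fun z => ((z - p) ^ (n + 1))⁻¹) c := by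
  rcases n with _ | n
  · exact ⟨1, by simpa using AuxD.inv p⟩
  · refine ⟨0, ?_⟩
    have h1 := (aux_inv p).pow 2
    have h2 := ((aux_inv p).trans aux_inv_one).pow n
    refine (h1.mul h2).congr ?_ ?_
    · intro z; simp only [← _root_.inv_pow]; ring
    · intro z; simp

lemma AuxD.lim {h : ℂ → ℂ} {c : ℂ} (H : AuxD h c) :
    Tendsto (fun x : ℝ => (x : ℂ) * h x) atTop (nhds c) := by
  have h1 : Tendsto (fun z => z * h z) (Bornology.cobounded ℂ) (nhds c) := by
    have h2 := (Asymptotics.isBigO_refl (fun z : ℂ => z) (Bornology.cobounded ℂ)).mul H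
    have h3 : (fun z => z * h z - c) =O[Bornology.cobounded ℂ] (fun z : ℂ => z⁻¹) := by
      refine h2.congr' ?_ ?_
      all_goals
        filter_upwards [aux_ne 0] with z hz0
        rw [sub_zero] at hz0
        field_simp
    have h4 := h3.trans_tendsto tendsto_inv₀_cobounded
    simpa using h4.add_const c
  have ht : Tendsto (fun x : ℝ => (x : ℂ)) atTop (Bornology.cobounded ℂ) := by
    rw [← tendsto_norm_atTop_iff_cobounded]
    simpa using tendsto_abs_atTop_atTop
  exact h1.comp ht

lemma AuxD.sub_inv {h : ℂ → ℂ} {c : ℂ} (H : AuxD h c) (p : ℂ) :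
    (fun z => h z - c * (z - p)⁻¹) =O[Bornology.cobounded ℂ] (fun z => (z⁻¹) ^ 2) := by
  refine (Asymptotics.IsBigO.sub H ((AuxD.inv p).smul c)).congr_left ?_
  intro z; ring

lemma aux_main (Λ : ℂ) (F G : ℂ → ℂ) (hF : AuxD F Λ) (hG : AuxD G Λ)
    (dF : ∀ z : ℂ, 0 ≤ z.im → DifferentiableAt ℂ F z)
    (dG : ∀ z : ℂ, z.im ≤ 0 → DifferentiableAt ℂ G z) :
    ∫ x : ℝ, (F x - G x) = -(2 * (Real.pi : ℂ) * I) * Λ := by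
  have n1 : ∀ z : ℂ, 0 ≤ z.im → z - (-I) ≠ 0 := by
    intro z hz h
    have := congrArg Complex.im h
    simp at this; linarith
  have n2 : ∀ z : ℂ, z.im ≤ 0 → z - I ≠ 0 := by
    intro z hz h
    have := congrArg Complex.im h
    simp at this; linarith
  obtain ⟨i1, z1⟩ := aux_int (fun z => F z - Λ * (z - (-I))⁻¹) (fun z hz => (dF z hz).sub
    (((differentiableAt_id.sub_const (-I)).inv (n1 z hz)).const_mul Λ)) (hF.sub_inv (-I))
  obtain ⟨i2, z2⟩ := aux_int' (fun z => G z - Λ * (z - I)⁻¹) (fun z hz => (dG z hz).sub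
    (((differentiableAt_id.sub_const I).inv (n2 z hz)).const_mul Λ)) (hG.sub_inv I)
  have i3 : Integrable (fun x : ℝ => (((1 + x ^ 2)⁻¹ : ℝ) : ℂ) * (-2 * I * Λ)) :=
    integrable_inv_one_add_sq.ofReal.mul_const _
  have e : ∀ x : ℝ, F x - G x = ((F x - Λ * ((x:ℂ) - (-I))⁻¹) - (G x - Λ * ((x:ℂ) - I)⁻¹))
      + (((1 + x ^ 2)⁻¹ : ℝ) : ℂ) * (-2 * I * Λ) := by
    intro x
    have a1 := n1 x (by simp)
    have a2 := n2 x (by simp)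
    have a3 : (((1 + x ^ 2)⁻¹ : ℝ) : ℂ) = ((x:ℂ) - (-I))⁻¹ * ((x:ℂ) - I)⁻¹ := by
      rw [← mul_inv]; push_cast; congr 1; linear_combination I_sq
    rw [a3]
    field_simp
    ring
  simp_rw [e]
  rw [integral_add (by exact i1.sub i2) i3, integral_sub i1 i2, z1, z2, integral_mul_const, integral_complex_ofReal,
    integral_univ_inv_one_add_sq]
  ring

theorem stmt_15 (k : ℕ) (p : Fin k → ℂ) (hp : ∀ j, (p j).im < 0) (m : Fin k → ℕ)
    (bu g : ℝ → ℂ)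
    (hbu : ∀ x : ℝ, bu x = ∏ j, (((x : ℂ) - (starRingEnd ℂ) (p j)) / ((x : ℂ) - p j)) ^ (m j))
    (hg : ∀ x : ℝ, g x = 1 - bu x)
    (a : (j : Fin k) → Fin (m j) → ℂ) (f : ℝ → ℂ)
    (hf : ∀ x : ℝ, f x = ∑ j, ∑ l, a j l / ((x : ℂ) - p j) ^ ((l : ℕ) + 1))
    (Λ : ℂ)
    (hΛ : Tendsto (fun x : ℝ => (x : ℂ) * f x) atTop (nhds Λ)) :
    ∀ x : ℝ, (x : ℂ) * f x - Λ * bu x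
      = ((x : ℂ) * f x - Λ)
        - (1 / (2 * (Real.pi : ℂ) * Complex.I)) * (∫ y : ℝ, f y * (starRingEnd ℂ) (g y)) * g x := by
  have np : ∀ j (z : ℂ), 0 ≤ z.im → z - p j ≠ 0 := by
    intro j z hz h
    have := congrArg Complex.im h
    have := hp j
    simp at *; linarith
  have nq : ∀ j (z : ℂ), z.im ≤ 0 → z - (starRingEnd ℂ) (p j) ≠ 0 := by
    intro j z hz h
    have := congrArg Complex.im h
    have := hp j
    simp at *; linarith
  let F : ℂ → ℂ := fun z => ∑ j, ∑ l, a j l * ((z - p j) ^ ((l : Fin (m j)) + 1 : ℕ))⁻¹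
  let B : ℂ → ℂ := fun z => ∏ j, ((z - p j) / (z - (starRingEnd ℂ) (p j))) ^ (m j)
  let G : ℂ → ℂ := fun z => ∑ j, ∑ l : Fin (m j), a j l *
    (((z - p j) ^ (m j - (l + 1)) / (z - (starRingEnd ℂ) (p j)) ^ (m j)) *
      ∏ i ∈ Finset.univ.erase j, ((z - p i) / (z - (starRingEnd ℂ) (p i))) ^ (m i))
  have hFf : ∀ x : ℝ, F x = f x := by
    intro x; rw [hf]; simp only [F, div_eq_mul_inv]
  have hGF : ∀ z : ℂ, (∀ j, z - p j ≠ 0) → F z * B z = G z := by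
    intro z hz
    simp only [F, G, Finset.sum_mul]
    refine Finset.sum_congr rfl fun j _ => Finset.sum_congr rfl fun l _ => ?_
    simp only [B]
    rw [← Finset.mul_prod_erase Finset.univ _ (Finset.mem_univ j), div_pow]
    have h1 : (z - p j) ^ (m j) = (z - p j) ^ (m j - (l + 1)) * (z - p j) ^ ((l : ℕ) + 1) := by
      rw [← pow_add, Nat.sub_add_cancel l.2]
    have h2 : (z - p j) ^ ((l : ℕ) + 1) ≠ 0 := pow_ne_zero _ (hz j)
    rw [h1]
    generalize (z - p j) ^ ((l : ℕ) + 1) = w at *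
    simp only [div_eq_mul_inv]
    have h3 : w⁻¹ * w = 1 := inv_mul_cancel₀ h2
    linear_combination (a j l * (z - p j) ^ (m j - (l + 1)) * ((z - (starRingEnd ℂ) (p j)) ^ (m j))⁻¹ *
      ∏ i ∈ Finset.univ.erase j, ((z - p i) * (z - (starRingEnd ℂ) (p i))⁻¹) ^ (m i)) * h3
  obtain ⟨c, hc⟩ : ∃ c, AuxD F c := by
    refine AuxD.sum _ _ fun j => AuxD.sum _ _ fun l => ?_
    obtain ⟨c, hc⟩ := AuxD.inv_pow (p j) l
    exact ⟨_, hc.smul (a j l)⟩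
  have hcΛ : c = Λ := by
    refine tendsto_nhds_unique hc.lim ?_
    simpa only [hFf] using hΛ
  subst hcΛ
  have hB : AuxB B := AuxB.prod _ _ fun j => (AuxB.frac _ _).pow _
  have hG : AuxD G c := by
    refine (hc.mul hB).congr ?_
    filter_upwards [eventually_all.2 fun j => aux_ne (p j)] with z hz
    exact hGF z hz
  have dF : ∀ z : ℂ, 0 ≤ z.im → DifferentiableAt ℂ F z := by
    intro z hz
    refine DifferentiableAt.fun_sum fun j _ => DifferentiableAt.fun_sum fun l _ => ?_
    refine DifferentiableAt.const_mul ?_ _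
    refine DifferentiableAt.fun_inv ?_ (pow_ne_zero _ (np j z hz))
    fun_prop
  have dG : ∀ z : ℂ, z.im ≤ 0 → DifferentiableAt ℂ G z := by
    intro z hz
    refine DifferentiableAt.fun_sum fun j _ => DifferentiableAt.fun_sum fun l _ => ?_
    refine DifferentiableAt.const_mul ?_ _
    refine DifferentiableAt.fun_mul ?_ ?_
    · exact DifferentiableAt.fun_div (by fun_prop) (by fun_prop) (pow_ne_zero _ (nq j z hz))
    · refine DifferentiableAt.fun_finsetProd fun i _ => ?_
      refine DifferentiableAt.fun_pow ?_ _
      refine DifferentiableAt.fun_div ?_ ?_ (nq i z hz)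
      · fun_prop
      · fun_prop
  have key := aux_main c F G hc hG dF dG
  have e : ∀ y : ℝ, f y * (starRingEnd ℂ) (g y) = F y - G y := by
    intro y
    rw [← hGF y (fun j => np j y (by simp)), hFf, hg, hbu]
    simp only [map_sub, map_one, map_prod, map_pow, map_div₀, Complex.conj_ofReal, Complex.conj_conj, B]
    ring
  intro x
  simp_rw [e]
  rw [key, hg]
  have hpi : (Real.pi : ℂ) ≠ 0 := by exact_mod_cast Real.pi_ne_zero
  have hI := I_ne_zero
  field_simp
  ring
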